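/- (Conditional decomposability of synchronous products, claim from Section 5.) Let Σ₁, Σ₂ ⊆ Σ and let Σ_k be a subalphabet with Σ₁ ∩ Σ₂ ⊆ Σ_k ⊆ Σ₁ ∪ Σ₂; write P_{i+k} for the natural projection onto Σ_i ∪ Σ_k (i = 1, 2) and P_k for the natural projection onto Σ_k. Let M₁ be a language over Σ₁ ∪ Σ_k and M₂ a language over Σ₂ ∪ Σ_k. Then P_{1+k}(M₁ ∥ M₂) = M₁ ∥ P_k(M₂), P_{2+k}(M₁ ∥ M₂) = M₂ ∥ P_k(M₁), and M₁ ∥ M₂ is conditionally decomposable with respect to (Σ₁, Σ₂, Σ_k), i.e., M₁ ∥ M₂ = P_{1+k}(M₁ ∥ M₂) ∥ P_{2+k}(M₁ ∥ M₂). -/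

import Mathlib

namespace CoordControl

variable {α : Type*}

/-- Natural projection onto subalphabet `A`: erase all letters outside `A`. -/
noncomputable def proj (A : Set α) (w : List α) : List α :=
  w.filter fun a => @decide (a ∈ A) (Classical.dec _)

/-- Projection of a language. -/
noncomputable def projL (A : Set α) (L : Set (List α)) : Set (List α) :=
  proj A '' L

/-- A word is over alphabet `A`. -/
def WordOver (A : Set α) (w : List α) : Prop := ∀ a ∈ w, a ∈ A

/-- A language is over alphabet `A`. -/
def LangOver (A : Set α) (L : Set (List α)) : Prop := ∀ w ∈ L, WordOver A w

/-- Synchronous product of `L₁` over `A₁` and `L₂` over `A₂`. -/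
def sync (A₁ A₂ : Set α) (L₁ L₂ : Set (List α)) : Set (List α) :=
  {w | WordOver (A₁ ∪ A₂) w ∧ proj A₁ w ∈ L₁ ∧ proj A₂ w ∈ L₂}

/-- Prefix closure. -/
def cl (L : Set (List α)) : Set (List α) := {w | ∃ u, w ++ u ∈ L}

/-- A language is prefix-closed if it equals its prefix closure. -/
def PrefixClosed (L : Set (List α)) : Prop := L = cl L

/-- `K` is controllable with respect to `L` and the uncontrollable events `U`. -/
def Controllable (K L : Set (List α)) (U : Set α) : Prop :=
  ∀ w ∈ cl K, ∀ a ∈ U, w ++ [a] ∈ L → w ++ [a] ∈ cl K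

/-- Supremal controllable sublanguage of `K` w.r.t. `L` and `U`. -/
def supC (K L : Set (List α)) (U : Set α) : Set (List α) :=
  ⋃₀ {M | M ⊆ K ∧ Controllable M L U}

/-- Infimal prefix-closed controllable superlanguage of `K` w.r.t. `L` and `U`. -/
def infC (K L : Set (List α)) (U : Set α) : Set (List α) :=
  ⋂₀ {M | K ⊆ M ∧ PrefixClosed M ∧ Controllable M L U}

/-- `M` over `A₁` and `N` over `A₂` are synchronously nonconflicting. -/
def Nonconflicting (A₁ A₂ : Set α) (M N : Set (List α)) : Prop :=
  cl (sync A₁ A₂ M N) = sync A₁ A₂ (cl M) (cl N)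

/-- The natural projection onto `A` is an `L`-observer. -/
def Observer (A : Set α) (L : Set (List α)) : Prop :=
  ∀ t ∈ projL A L, ∀ s ∈ cl L, proj A s <+: t →
    ∃ u, s ++ u ∈ L ∧ proj A (s ++ u) = t

/-- The natural projection onto `A` is locally control consistent (LCC) for `L`,
with uncontrollable events `U`. -/
def LCC (A U : Set α) (L : Set (List α)) : Prop :=
  ∀ s ∈ cl L, ∀ σ ∈ U ∩ A,
    (∃ u, WordOver Aᶜ u ∧ s ++ u ++ [σ] ∈ cl L) →
    ∃ u', WordOver (Aᶜ ∩ U) u' ∧ s ++ u' ++ [σ] ∈ cl L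

/-- The coordinator `L_k = P_k(L₁) ∥ P_k(L₂)`. -/
noncomputable def coord (Ek : Set α) (L₁ L₂ : Set (List α)) : Set (List α) :=
  sync Ek Ek (projL Ek L₁) (projL Ek L₂)

/-- `K` is conditionally decomposable w.r.t. `(E₁, E₂, Ek)`. -/
noncomputable def CondDecomposable (E₁ E₂ Ek : Set α) (K : Set (List α)) : Prop :=
  K = sync (E₁ ∪ Ek) (E₂ ∪ Ek) (projL (E₁ ∪ Ek) K) (projL (E₂ ∪ Ek) K)

/-- A pair `(M₁, M₂)` is a solution of Problem 1 for the specification `K`: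
`M₁` is over `E₁ ∪ Ek`, `M₂` over `E₂ ∪ Ek`, `cl Mᵢ ⊆ Lᵢ ∥ L_k`, `cl Mᵢ` is
controllable w.r.t. `Lᵢ ∥ L_k` and `Σ_{i+k,u}`, and `M₁ ∥ M₂ = K`,
`cl M₁ ∥ cl M₂ = cl K`. -/
noncomputable def IsSolution (E₁ E₂ Ek U : Set α) (L₁ L₂ K M₁ M₂ : Set (List α)) : Prop :=
  LangOver (E₁ ∪ Ek) M₁ ∧ LangOver (E₂ ∪ Ek) M₂ ∧
  cl M₁ ⊆ sync E₁ Ek L₁ (coord Ek L₁ L₂) ∧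
  cl M₂ ⊆ sync E₂ Ek L₂ (coord Ek L₁ L₂) ∧
  Controllable (cl M₁) (sync E₁ Ek L₁ (coord Ek L₁ L₂)) ((E₁ ∪ Ek) ∩ U) ∧
  Controllable (cl M₂) (sync E₂ Ek L₂ (coord Ek L₁ L₂)) ((E₂ ∪ Ek) ∩ U) ∧
  sync (E₁ ∪ Ek) (E₂ ∪ Ek) M₁ M₂ = K ∧
  sync (E₁ ∪ Ek) (E₂ ∪ Ek) (cl M₁) (cl M₂) = cl K

/-- `M` is relaxed conditionally controllable w.r.t. plants `L₁`, `L₂` and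
coordinator `Lk`. -/
noncomputable def RelaxedCC (E₁ E₂ Ek U : Set α) (L₁ L₂ Lk M : Set (List α)) : Prop :=
  Controllable (projL (E₁ ∪ Ek) M) (sync E₁ Ek L₁ Lk) ((E₁ ∪ Ek) ∩ U) ∧
  Controllable (projL (E₂ ∪ Ek) M) (sync E₂ Ek L₂ Lk) ((E₂ ∪ Ek) ∩ U)

/-- `M` is conditionally controllable (original framework) w.r.t. plants `L₁`, `L₂`
and coordinator `Lk`. -/
noncomputable def CondControllable (E₁ E₂ Ek U : Set α) (L₁ L₂ Lk M : Set (List α)) : Prop :=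
  Controllable (projL Ek M) Lk (Ek ∩ U) ∧
  Controllable (projL (E₁ ∪ Ek) M) (sync E₁ Ek L₁ (cl (projL Ek M))) ((E₁ ∪ Ek) ∩ U) ∧
  Controllable (projL (E₂ ∪ Ek) M) (sync E₂ Ek L₂ (cl (projL Ek M))) ((E₂ ∪ Ek) ∩ U)

theorem proj_nil (A : Set α) : proj A [] = [] := rfl

theorem proj_cons_of_mem {A : Set α} {a : α} (h : a ∈ A) (w : List α) :
    proj A (a :: w) = a :: proj A w := by
  simp [proj, h]

theorem proj_cons_of_notMem {A : Set α} {a : α} (h : a ∉ A) (w : List α) :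
    proj A (a :: w) = proj A w := by
  simp [proj, h]

theorem mem_proj {A : Set α} {a : α} {w : List α} : a ∈ proj A w ↔ a ∈ w ∧ a ∈ A := by
  simp [proj]

theorem proj_append (A : Set α) (u v : List α) : proj A (u ++ v) = proj A u ++ proj A v := by
  simp [proj]

theorem proj_eq_self {A : Set α} {w : List α} (h : WordOver A w) : proj A w = w := by
  simpa [proj, WordOver] using h

theorem proj_eq_nil {A : Set α} {w : List α} : proj A w = [] ↔ ∀ a ∈ w, a ∉ A := by
  simp [proj]

theorem proj_proj (A B : Set α) (w : List α) : proj A (proj B w) = proj (A ∩ B) w := by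
  unfold proj
  rw [List.filter_filter]
  refine List.filter_congr fun a _ => ?_
  rw [Bool.eq_iff_iff]
  simp

theorem proj_eq_cons {A : Set α} {a : α} {v t : List α} (h : proj A v = a :: t) :
    ∃ l v', v = l ++ a :: v' ∧ (∀ b ∈ l, b ∉ A) ∧ proj A v' = t := by
  obtain ⟨l, v', rfl, hl, -, ht⟩ := List.filter_eq_cons_iff.mp h
  exact ⟨l, v', rfl, by simpa using hl, ht⟩

theorem sync_comm (A B : Set α) (M N : Set (List α)) : sync A B M N = sync B A N M := by
  ext w
  simp only [sync, Set.mem_ofPred_eq, Set.union_comm A B, and_comm (a := proj A w ∈ M)]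

/-- Two words with the same projection to the common letters are the projections of one word. -/
theorem exists_merge {A B : Set α} {u v : List α} (hu : WordOver A u) (hv : WordOver B v)
    (h : proj (A ∩ B) u = proj (A ∩ B) v) :
    ∃ w, WordOver (A ∪ B) w ∧ proj A w = u ∧ proj B w = v := by
  induction u generalizing v with
  | nil =>
    refine ⟨v, fun a ha => .inr (hv a ha), ?_, proj_eq_self hv⟩
    rw [proj_nil, eq_comm, proj_eq_nil] at h
    exact proj_eq_nil.mpr fun a ha haA => h a ha ⟨haA, hv a ha⟩
  | cons a u ih =>
    have haA : a ∈ A := hu a (by simp)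
    have hu' : WordOver A u := fun b hb => hu b (by simp [hb])
    by_cases haB : a ∈ B
    · rw [proj_cons_of_mem (A := A ∩ B) ⟨haA, haB⟩] at h
      obtain ⟨l, v', rfl, hl, ht⟩ := proj_eq_cons h.symm
      have hlB : WordOver B l := fun b hb => hv b (by simp [hb])
      have hlA : proj A l = [] := proj_eq_nil.mpr fun b hb hbA => hl b hb ⟨hbA, hlB b hb⟩
      obtain ⟨w, hw, hwu, hwv⟩ := ih hu' (fun b hb => hv b (by simp [hb])) ht.symm
      refine ⟨l ++ a :: w, fun b hb => ?_, ?_, ?_⟩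
      · rcases List.mem_append.mp hb with hb | hb
        · exact .inr (hlB b hb)
        · rcases List.mem_cons.mp hb with rfl | hb
          · exact .inl haA
          · exact hw b hb
      · rw [proj_append, hlA, proj_cons_of_mem haA, hwu, List.nil_append]
      · rw [proj_append, proj_eq_self hlB, proj_cons_of_mem haB, hwv]
    · rw [proj_cons_of_notMem (A := A ∩ B) fun hab => haB hab.2] at h
      obtain ⟨w, hw, hwu, hwv⟩ := ih hu' hv h
      refine ⟨a :: w, fun b hb => ?_, ?_, ?_⟩
      · rcases List.mem_cons.mp hb with rfl | hb
        · exact .inl haA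
        · exact hw b hb
      · rw [proj_cons_of_mem haA, hwu]
      · rw [proj_cons_of_notMem haB, hwv]

/-- Projecting a synchronous product to the alphabet of its first factor. -/
theorem projL_sync (A B : Set α) (M : Set (List α)) {N : Set (List α)} (hN : LangOver B N) :
    projL A (sync A B M N) = sync A (A ∩ B) M (projL (A ∩ B) N) := by
  ext u
  constructor
  · rintro ⟨w, ⟨-, hwM, hwN⟩, rfl⟩
    refine ⟨fun a ha => .inl (mem_proj.mp ha).2, ?_, proj B w, hwN, ?_⟩
    · rwa [proj_proj, Set.inter_self]
    · rw [proj_proj, proj_proj, Set.inter_assoc, Set.inter_self, Set.inter_right_comm,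
        Set.inter_self]
  · rintro ⟨hu, huM, v, hvN, hv⟩
    have huA : WordOver A u := fun a ha => (hu a ha).elim id And.left
    obtain ⟨w, hw, rfl, rfl⟩ := exists_merge huA (hN v hvN) hv.symm
    rw [proj_proj, Set.inter_self] at huM
    exact ⟨w, ⟨hw, huM, hvN⟩, rfl⟩

/-- A synchronous product is the synchronous product of its projections. -/
theorem sync_projL_sync (A B : Set α) (M N : Set (List α)) :
    sync A B (projL A (sync A B M N)) (projL B (sync A B M N)) = sync A B M N := by
  ext w
  constructor
  · rintro ⟨hw, ⟨x, hx, hxw⟩, y, hy, hyw⟩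
    exact ⟨hw, hxw ▸ hx.2.1, hyw ▸ hy.2.2⟩
  · exact fun hw => ⟨hw.1, ⟨w, hw, rfl⟩, w, hw, rfl⟩

/-- Conditional decomposability of synchronous products (Section 5). -/
theorem cond_decomposability_of_sync
    (E₁ E₂ Ek : Set α)
    (hInter : E₁ ∩ E₂ ⊆ Ek) (hSub : Ek ⊆ E₁ ∪ E₂)
    (M₁ M₂ : Set (List α))
    (hM1 : LangOver (E₁ ∪ Ek) M₁) (hM2 : LangOver (E₂ ∪ Ek) M₂) :
    projL (E₁ ∪ Ek) (sync (E₁ ∪ Ek) (E₂ ∪ Ek) M₁ M₂) =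
      sync (E₁ ∪ Ek) Ek M₁ (projL Ek M₂) ∧
    projL (E₂ ∪ Ek) (sync (E₁ ∪ Ek) (E₂ ∪ Ek) M₁ M₂) =
      sync (E₂ ∪ Ek) Ek M₂ (projL Ek M₁) ∧
    CondDecomposable E₁ E₂ Ek (sync (E₁ ∪ Ek) (E₂ ∪ Ek) M₁ M₂) := by
  have hK : (E₁ ∪ Ek) ∩ (E₂ ∪ Ek) = Ek := by
    rw [← Set.inter_union_distrib_right, Set.union_eq_self_of_subset_left hInter]
  refine ⟨?_, ?_, (sync_projL_sync _ _ _ _).symm⟩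
  · rw [projL_sync _ _ _ hM2, hK]
  · rw [sync_comm, projL_sync _ _ _ hM1, Set.inter_comm, hK]

end CoordControl
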